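/- arXiv:2108.00314 — 3 statements merged into one kernel-verified Lean document; each statement's English description precedes it below -/
import Mathlib

section
/- Let T ≥ 1, n ≥ 1, X = ℝ^T with the ℓ2 (Euclidean) metric, and let R be the element-wise mean rule. Then for every ε > 0, every deliberation process converges. -/
/-- A deliberation process: at each iteration `j`, every agent `i` moves from `V j i`
to `V (j+1) i`, subject to constraints (C1) and (C2) with respect to the current
winner `R (V j)` and step size `ε`. -/
def DelibProcess {X : Type*} {n : ℕ} (d : X → X → ℝ) (R : (Fin n → X) → X) (ε : ℝ)
    (V : ℕ → Fin n → X) : Prop :=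
  ∀ (i : Fin n) (j : ℕ),
    d (V (j + 1) i) (R (V j)) = max 0 (d (V j i) (R (V j)) - ε) ∧
    (0 < d (V (j + 1) i) (R (V j)) → d (V (j + 1) i) (V j i) = ε) ∧
    (d (V (j + 1) i) (R (V j)) = 0 → d (V (j + 1) i) (V j i) ≤ ε)

/-- The process converges: from some iteration on, the profile never changes. -/
def Converges {X : Type*} {n : ℕ} (V : ℕ → Fin n → X) : Prop :=
  ∃ N : ℕ, ∀ j : ℕ, N ≤ j → V j = V N
/-- The ℓ2 (Euclidean) distance on ℝ^T. -/
noncomputable def l2dist {T : ℕ} (x y : Fin T → ℝ) : ℝ :=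
  Real.sqrt (∑ t : Fin T, (x t - y t) ^ 2)

/-- The element-wise mean rule on ℝ^T. -/
noncomputable def meanRule {T n : ℕ} (V : Fin n → Fin T → ℝ) : Fin T → ℝ :=
  fun t => (∑ i : Fin n, V i t) / (n : ℝ)

theorem l2dist_nonneg {T : ℕ} (x y : Fin T → ℝ) : 0 ≤ l2dist x y :=
  Real.sqrt_nonneg _

theorem l2dist_sq {T : ℕ} (x y : Fin T → ℝ) : l2dist x y ^ 2 = ∑ t, (x t - y t) ^ 2 :=
  Real.sq_sqrt (Finset.sum_nonneg fun _ _ => sq_nonneg _)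

theorem eq_of_l2dist_eq_zero {T : ℕ} {x y : Fin T → ℝ} (h : l2dist x y = 0) : x = y := by
  have hs : ∑ t, (x t - y t) ^ 2 = 0 := by rw [← l2dist_sq, h, zero_pow two_ne_zero]
  rw [Finset.sum_eq_zero_iff_of_nonneg fun _ _ => sq_nonneg _] at hs
  funext t
  exact sub_eq_zero.mp (pow_eq_zero_iff two_ne_zero |>.mp (hs t (Finset.mem_univ t)))

/-- The mean minimizes the sum of squared deviations. -/
theorem sum_sq_sub_mean_le {n : ℕ} (hn : 1 ≤ n) (a : Fin n → ℝ) (c : ℝ) :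
    ∑ i, (a i - (∑ k, a k) / n) ^ 2 ≤ ∑ i, (a i - c) ^ 2 := by
  have hn' : (n : ℝ) ≠ 0 := by positivity
  set m := (∑ k, a k) / (n : ℝ) with hm
  have hsum : ∑ k, a k = n * m := by rw [hm]; field_simp
  have key : ∑ i, (a i - c) ^ 2 = ∑ i, (a i - m) ^ 2 + n * (m - c) ^ 2 := by
    have hterm (i : Fin n) :
        (a i - c) ^ 2 = (a i - m) ^ 2 + (2 * (m - c) * a i + (c ^ 2 - m ^ 2)) := by ring
    simp only [hterm, Finset.sum_add_distrib, ← Finset.mul_sum, hsum, Finset.sum_const,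
      Finset.card_univ, Fintype.card_fin, nsmul_eq_mul]
    ring
  rw [key]
  exact le_add_of_nonneg_right (by positivity)

theorem sum_l2dist_sq_meanRule_le {T n : ℕ} (hn : 1 ≤ n) (V : Fin n → Fin T → ℝ)
    (c : Fin T → ℝ) :
    ∑ i, l2dist (V i) (meanRule V) ^ 2 ≤ ∑ i, l2dist (V i) c ^ 2 := by
  simp only [l2dist_sq]
  rw [Finset.sum_comm, Finset.sum_comm (f := fun i t => (V i t - c t) ^ 2)]
  exact Finset.sum_le_sum fun t _ => sum_sq_sub_mean_le hn (fun i => V i t) (c t)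

theorem meanRule_const {T n : ℕ} (hn : 1 ≤ n) (w : Fin T → ℝ) :
    meanRule (fun _ : Fin n => w) = w := by
  have hn' : (n : ℝ) ≠ 0 := by positivity
  funext t
  simp [meanRule, hn']

theorem max_zero_sub_sq_le {ε r : ℝ} (hε : 0 < ε) (hr : 0 ≤ r) :
    max 0 (r - ε) ^ 2 ≤ r ^ 2 :=
  pow_le_pow_left₀ (le_max_left _ _) (max_le hr (by linarith)) 2

theorem DelibProcess.sum_l2dist_sq_succ_le {T n : ℕ} (hn : 1 ≤ n) {ε : ℝ} (hε : 0 < ε)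
    {V : ℕ → Fin n → Fin T → ℝ} (hV : DelibProcess l2dist meanRule ε V) {j : ℕ} {k : Fin n}
    (hk : ε < l2dist (V j k) (meanRule (V j))) :
    ∑ i, l2dist (V (j + 1) i) (meanRule (V (j + 1))) ^ 2 ≤
      ∑ i, l2dist (V j i) (meanRule (V j)) ^ 2 - ε ^ 2 := by
  have hle := sum_l2dist_sq_meanRule_le hn (V (j + 1)) (meanRule (V j))
  simp only [fun i => (hV i j).1] at hle
  have hk' : max 0 (l2dist (V j k) (meanRule (V j)) - ε) ^ 2 + ε ^ 2 ≤
      l2dist (V j k) (meanRule (V j)) ^ 2 := by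
    rw [max_eq_right (by linarith)]
    nlinarith
  have hrest := Finset.sum_le_sum fun i (_ : i ∈ Finset.univ.erase k) =>
    max_zero_sub_sq_le hε (l2dist_nonneg (V j i) (meanRule (V j)))
  rw [← Finset.add_sum_erase _ (fun i => max 0 (l2dist (V j i) (meanRule (V j)) - ε) ^ 2)
    (Finset.mem_univ k)] at hle
  rw [← Finset.add_sum_erase _ (fun i => l2dist (V j i) (meanRule (V j)) ^ 2)
    (Finset.mem_univ k)]
  linarith

theorem DelibProcess.exists_forall_l2dist_le {T n : ℕ} (hn : 1 ≤ n) {ε : ℝ} (hε : 0 < ε)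
    {V : ℕ → Fin n → Fin T → ℝ} (hV : DelibProcess l2dist meanRule ε V) :
    ∃ j, ∀ i, l2dist (V j i) (meanRule (V j)) ≤ ε := by
  by_contra! h
  have hbound (j : ℕ) : ∑ i, l2dist (V j i) (meanRule (V j)) ^ 2 ≤
      ∑ i, l2dist (V 0 i) (meanRule (V 0)) ^ 2 - j * ε ^ 2 := by
    induction j with
    | zero => simp
    | succ j ih =>
      obtain ⟨k, hk⟩ := h j
      have := hV.sum_l2dist_sq_succ_le hn hε hk
      push_cast
      linarith
  obtain ⟨j, hj⟩ := exists_lt_nsmul (pow_pos hε 2) (∑ i, l2dist (V 0 i) (meanRule (V 0)) ^ 2)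
  rw [nsmul_eq_mul] at hj
  have hnonneg : 0 ≤ ∑ i, l2dist (V j i) (meanRule (V j)) ^ 2 :=
    Finset.sum_nonneg fun _ _ => sq_nonneg _
  linarith [hbound j]

theorem DelibProcess.succ_eq_const {T n : ℕ} {ε : ℝ} {V : ℕ → Fin n → Fin T → ℝ}
    (hV : DelibProcess l2dist meanRule ε V) {j : ℕ}
    (h : ∀ i, l2dist (V j i) (meanRule (V j)) ≤ ε) :
    V (j + 1) = fun _ => meanRule (V j) := by
  funext i
  apply eq_of_l2dist_eq_zero
  rw [(hV i j).1, max_eq_left (sub_nonpos.mpr (h i))]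

/-- On ℝ^T with the ℓ2 metric and the element-wise mean rule, every deliberation
process converges. -/
theorem stmt8 {T n : ℕ} (hT : 1 ≤ T) (hn : 1 ≤ n) {ε : ℝ} (hε : 0 < ε)
    (V : ℕ → Fin n → (Fin T → ℝ)) (hV : DelibProcess l2dist meanRule ε V) :
    Converges V := by
  obtain ⟨N, hN⟩ := hV.exists_forall_l2dist_le hn hε
  refine ⟨N + 1, fun j hj => ?_⟩
  induction j, hj using Nat.le_induction with
  | base => rfl
  | succ j _ ih =>
    rw [hV.succ_eq_const hN] at ih ⊢
    have hmean : meanRule (V j) = meanRule (V N) := by rw [ih, meanRule_const hn]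
    rw [hV.succ_eq_const fun i => ?_, hmean]
    rw [hmean, ih]
    simpa [l2dist] using hε.le
end

section
/- Let m ≥ 1 and 1 ≤ k ≤ m, let X be the set of binary vectors in {0,1}^m with exactly k ones (k-element committees), equipped with the Hamming distance, let ε be a positive integer, and let R : X^n → X be a monotonic MW rule. Then in every deliberation process the winner is invariant, w^j = w^0 for all j, and the process converges to the consensus w^0 after exactly max_i ⌈d(v_i^0, w^0)/ε⌉ iterations; in particular convergence is guaranteed. -/
/-- A committee of size k out of m candidates: a binary vector with exactly k ones. -/
def Committee (m k : ℕ) : Type :=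
  {x : Fin m → Bool // (Finset.univ.filter fun t : Fin m => x t = true).card = k}

/-- An MW (multiwinner) rule is monotonic if, whenever a single agent simultaneously
flips one coordinate from 1 to 0 at a position where the winner has a 0 and one
coordinate from 0 to 1 at a position where the winner has a 1, the winner stays the
same. -/
def MWMonotonic {m k n : ℕ} (R : (Fin n → Committee m k) → Committee m k) : Prop :=
  ∀ (V V' : Fin n → Committee m k) (i : Fin n) (t₁ t₂ : Fin m), t₁ ≠ t₂ →
    (∀ i' : Fin n, i' ≠ i → V' i' = V i') →
    (∀ t : Fin m, t ≠ t₁ → t ≠ t₂ → (V' i).val t = (V i).val t) →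
    (V i).val t₁ = true → (R V).val t₁ = false → (V' i).val t₁ = false →
    (V i).val t₂ = false → (R V).val t₂ = true → (V' i).val t₂ = true →
    R V' = R V

namespace Committee

variable {m k : ℕ}

theorem exists_mem_notMem_of_ne {x y : Committee m k} (h : x ≠ y) :
    ∃ t, x.val t = true ∧ y.val t = false := by
  by_contra! hxy
  refine h (Subtype.ext (funext fun t => ?_))
  have hsub : (Finset.univ.filter fun t => x.val t = true) ⊆
      Finset.univ.filter fun t => y.val t = true := fun t ht => by
    simpa using hxy t (by simpa using ht)
  have heq := Finset.eq_of_subset_of_card_le hsub (by rw [x.2, y.2])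
  have ht := congrArg (t ∈ ·) heq
  simp only [Finset.mem_filter, Finset.mem_univ, true_and, eq_iff_iff] at ht
  exact Bool.eq_iff_iff.2 ht

/-- The committee obtained by exchanging the roles of two candidates. -/
def swap (x : Committee m k) (a b : Fin m) : Committee m k :=
  ⟨x.val ∘ Equiv.swap a b, 
    (Finset.card_equiv (Equiv.swap a b) (by simp)).trans x.2⟩

theorem swap_val_left (x : Committee m k) (a b : Fin m) : (x.swap a b).val a = x.val b := by
  simp [swap]

theorem swap_val_right (x : Committee m k) (a b : Fin m) : (x.swap a b).val b = x.val a := by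
  simp [swap]

theorem swap_val_of_ne (x : Committee m k) {a b t : Fin m} (ha : t ≠ a) (hb : t ≠ b) :
    (x.swap a b).val t = x.val t := by
  simp [swap, Equiv.swap_apply_of_ne_of_ne ha hb]

theorem hammingDist_swap_lt {x y : Committee m k} {a b : Fin m}
    (hxa : x.val a = true) (hya : y.val a = false)
    (hxb : x.val b = false) (hyb : y.val b = true) :
    hammingDist (x.swap a b).val y.val < hammingDist x.val y.val := by
  refine Finset.card_lt_card (Finset.ssubset_iff_of_subset (fun t ht => ?_) |>.2 ⟨a, ?_, ?_⟩)
  · by_cases hta : t = a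
    · subst hta; simp [hxa, hya]
    by_cases htb : t = b
    · subst htb; simp [hxb, hyb]
    simpa [swap_val_of_ne x hta htb] using ht
  · simp [hxa, hya]
  · simp [swap_val_left, hxb, hya]

end Committee

/-- Equality in the triangle inequality for the Hamming distance forces each coordinate of the
middle point to agree with one of the endpoints. -/
theorem eq_or_eq_of_hammingDist_add_le {ι : Type*} [Fintype ι] {β : ι → Type*}
    [∀ i, DecidableEq (β i)] {x y z : ∀ i, β i}
    (h : hammingDist y x + hammingDist y z ≤ hammingDist x z) (t : ι) :
    y t = x t ∨ y t = z t := by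
  classical
  by_contra! ht
  simp only [hammingDist] at h
  rw [← Finset.card_union_add_card_inter] at h
  have hsub : (Finset.univ.filter fun i => x i ≠ z i) ⊆
      (Finset.univ.filter fun i => y i ≠ x i) ∪ Finset.univ.filter fun i => y i ≠ z i := by
    intro i
    simp only [Finset.mem_union, Finset.mem_filter, Finset.mem_univ, true_and]
    grind
  have hpos : 0 < ((Finset.univ.filter fun i => y i ≠ x i) ∩
      Finset.univ.filter fun i => y i ≠ z i).card :=
    Finset.card_pos.2 ⟨t, by simp [ht.1, ht.2]⟩
  have := Finset.card_le_card hsub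
  omega

/-- A monotonic rule keeps its winner when all agents move along geodesics towards it. -/
theorem MWMonotonic.apply_eq_of_between {m k n : ℕ}
    {R : (Fin n → Committee m k) → Committee m k} (hR : MWMonotonic R)
    (U U' : Fin n → Committee m k)
    (h : ∀ i t, (U' i).val t = (U i).val t ∨ (U' i).val t = (R U).val t) :
    R U' = R U := by
  induction hN : ∑ i, hammingDist (U i).val (U' i).val using Nat.strong_induction_on
    generalizing U with
  | _ N ih =>
    by_cases heq : U = U'
    · rw [heq]
    obtain ⟨i, hi⟩ := Function.ne_iff.1 heq
    obtain ⟨a, hxa, hya⟩ := Committee.exists_mem_notMem_of_ne hi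
    obtain ⟨b, hyb, hxb⟩ := Committee.exists_mem_notMem_of_ne hi.symm
    have hwa : (R U).val a = false := by
      have := h i a
      simp_all
    have hwb : (R U).val b = true := by
      have := h i b
      simp_all
    have hab : a ≠ b := by
      rintro rfl
      simp_all
    have hstep : R (Function.update U i ((U i).swap a b)) = R U := by
      refine hR U _ i a b hab (fun i' hi' => Function.update_of_ne hi' _ _) ?_ hxa hwa ?_ hxb hwb ?_
      · intro t hta htb
        rw [Function.update_self, Committee.swap_val_of_ne _ hta htb]
      · rw [Function.update_self, Committee.swap_val_left, hxb]
      · rw [Function.update_self, Committee.swap_val_right, hxa]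
    have hlt : ∑ i', hammingDist (Function.update U i ((U i).swap a b) i').val (U' i').val < N := by
      rw [← hN]
      refine Finset.sum_lt_sum (fun i' _ => ?_) ⟨i, Finset.mem_univ i, ?_⟩
      · by_cases hi' : i' = i
        · subst hi'
          rw [Function.update_self]
          exact (Committee.hammingDist_swap_lt hxa hya hxb hyb).le
        · rw [Function.update_of_ne hi']
      · rw [Function.update_self]
        exact Committee.hammingDist_swap_lt hxa hya hxb hyb
    rw [← hstep]
    refine ih _ hlt _ (fun i' t => ?_) rfl
    rw [hstep]
    by_cases hi' : i' = i
    · subst hi'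
      rw [Function.update_self]
      by_cases hta : t = a
      · subst hta; exact Or.inr (hya.trans hwa.symm)
      by_cases htb : t = b
      · subst htb; exact Or.inr (hyb.trans hwb.symm)
      rw [Committee.swap_val_of_ne _ hta htb]
      exact h i' t
    · rw [Function.update_of_ne hi']
      exact h i' t

section DelibProcess

variable {m k n ε : ℕ} {R : (Fin n → Committee m k) → Committee m k} {V : ℕ → Fin n → Committee m k}

theorem DelibProcess.hammingDist_succ
    (hV : DelibProcess (fun x y => (hammingDist x.val y.val : ℝ)) R (ε : ℝ) V)
    (i : Fin n) (j : ℕ) :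
    hammingDist (V (j + 1) i).val (R (V j)).val = hammingDist (V j i).val (R (V j)).val - ε := by
  have h : (hammingDist (V (j + 1) i).val (R (V j)).val : ℝ) =
      max 0 ((hammingDist (V j i).val (R (V j)).val : ℝ) - ε) := (hV i j).1
  rcases le_total (hammingDist (V j i).val (R (V j)).val) ε with hle | hle
  · have hle' : (hammingDist (V j i).val (R (V j)).val : ℝ) ≤ ε := by exact_mod_cast hle
    rw [max_eq_left (by linarith)] at h
    rw [Nat.sub_eq_zero_of_le hle]
    exact_mod_cast h
  · have hle' : (ε : ℝ) ≤ hammingDist (V j i).val (R (V j)).val := by exact_mod_cast hle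
    rw [max_eq_right (by linarith), ← Nat.cast_sub hle] at h
    exact_mod_cast h

theorem DelibProcess.between
    (hV : DelibProcess (fun x y => (hammingDist x.val y.val : ℝ)) R (ε : ℝ) V)
    (i : Fin n) (j : ℕ) (t : Fin m) :
    (V (j + 1) i).val t = (V j i).val t ∨ (V (j + 1) i).val t = (R (V j)).val t := by
  have hd := hV.hammingDist_succ i j
  rcases Nat.eq_zero_or_pos (hammingDist (V (j + 1) i).val (R (V j)).val) with h0 | hpos
  · exact Or.inr (congrFun (hammingDist_eq_zero.1 h0) t)
  · have hmove : hammingDist (V (j + 1) i).val (V j i).val = ε :=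
      Nat.cast_injective ((hV i j).2.1 (Nat.cast_pos.2 hpos))
    exact eq_or_eq_of_hammingDist_add_le (by omega) t

theorem DelibProcess.winner_eq (hR : MWMonotonic R)
    (hV : DelibProcess (fun x y => (hammingDist x.val y.val : ℝ)) R (ε : ℝ) V) (j : ℕ) :
    R (V j) = R (V 0) := by
  induction j with
  | zero => rfl
  | succ j ih => rw [hR.apply_eq_of_between (V j) (V (j + 1)) fun i t => hV.between i j t, ih]

theorem DelibProcess.hammingDist_eq (hR : MWMonotonic R)
    (hV : DelibProcess (fun x y => (hammingDist x.val y.val : ℝ)) R (ε : ℝ) V)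
    (i : Fin n) (j : ℕ) :
    hammingDist (V j i).val (R (V 0)).val = hammingDist (V 0 i).val (R (V 0)).val - j * ε := by
  induction j with
  | zero => simp
  | succ j ih =>
    have h := hV.hammingDist_succ i j
    rw [hV.winner_eq hR j, ih] at h
    rw [h, Nat.sub_sub, Nat.succ_mul]

theorem DelibProcess.eq_winner_iff (hε : 1 ≤ ε) (hR : MWMonotonic R)
    (hV : DelibProcess (fun x y => (hammingDist x.val y.val : ℝ)) R (ε : ℝ) V)
    (i : Fin n) (j : ℕ) :
    V j i = R (V 0) ↔ ⌈(hammingDist (V 0 i).val (R (V 0)).val : ℝ) / (ε : ℝ)⌉₊ ≤ j := by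
  have hε' : (0 : ℝ) < ε := by exact_mod_cast hε
  have hval : V j i = R (V 0) ↔ (V j i).val = (R (V 0)).val := Subtype.ext_iff
  rw [Nat.ceil_le, div_le_iff₀ hε', hval, ← hammingDist_eq_zero,
    hV.hammingDist_eq hR, Nat.sub_eq_zero_iff_le]
  exact_mod_cast Iff.rfl

end DelibProcess

/-- On the set of k-committees of m candidates with the Hamming distance and a
monotonic MW rule: in every deliberation process (integer ε ≥ 1) the winner is
invariant, and the process converges to the consensus w^0 after exactly
max_i ⌈d(v_i^0, w^0)/ε⌉ iterations. -/
theorem stmt15 {m k n : ℕ} (hm : 1 ≤ m) (hk : 1 ≤ k) (hkm : k ≤ m)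
    {ε : ℕ} (hε : 1 ≤ ε)
    (R : (Fin n → Committee m k) → Committee m k) (hR : MWMonotonic R)
    (V : ℕ → Fin n → Committee m k)
    (hV : DelibProcess (fun x y => (hammingDist x.val y.val : ℝ)) R (ε : ℝ) V) :
    (∀ j : ℕ, R (V j) = R (V 0)) ∧
    (∀ j : ℕ,
      (Finset.univ.sup fun i : Fin n =>
        ⌈(hammingDist (V 0 i).val (R (V 0)).val : ℝ) / (ε : ℝ)⌉₊) ≤ j →
      ∀ i : Fin n, V j i = R (V 0)) ∧
    (∀ j : ℕ,
      j < (Finset.univ.sup fun i : Fin n =>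
        ⌈(hammingDist (V 0 i).val (R (V 0)).val : ℝ) / (ε : ℝ)⌉₊) →
      ∃ i : Fin n, V j i ≠ R (V 0)) ∧
    Converges V := by
  generalize hT : (Finset.univ.sup fun i : Fin n =>
    ⌈(hammingDist (V 0 i).val (R (V 0)).val : ℝ) / (ε : ℝ)⌉₊) = T
  have hconsensus (j : ℕ) : T ≤ j ↔ ∀ i : Fin n, V j i = R (V 0) := by
    simp only [← hT, Finset.sup_le_iff, Finset.mem_univ, true_imp_iff, hV.eq_winner_iff hε hR]
  refine ⟨hV.winner_eq hR, fun j => (hconsensus j).1, fun j hj => ?_,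
    T, fun j hj => funext fun i => ?_⟩
  · by_contra! h
    exact hj.not_ge ((hconsensus j).2 h)
  · rw [(hconsensus j).1 hj i, (hconsensus T).1 le_rfl i]
end

section
/- Let X be the set of rankings of m candidates, let d be any metric on X, let ε > 0, and let R : X^n → X be a rule such that for every profile U ∈ X^n, R(U) is the unique minimizer over X of x ↦ Σ_i d(u_i, x) (a Kemeny-style rule). Then in every deliberation process the winner is invariant, w^j = w^0 for all j, and the process converges to the consensus w^0 after exactly max_i ⌈d(v_i^0, w^0)/ε⌉ iterations; in particular convergence is guaranteed. -/
theorem dist_nonneg_of_triangle {X : Type*} {d : X → X → ℝ} (hd0 : ∀ x y, d x y = 0 ↔ x = y)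
    (hdsymm : ∀ x y, d x y = d y x) (hdtri : ∀ x y z, d x z ≤ d x y + d y z) (x y : X) :
    0 ≤ d x y := by
  have h := hdtri x y x
  rw [(hd0 x x).2 rfl, hdsymm y x] at h
  linarith

/-- Each agent moves along a geodesic towards the current winner. -/
theorem DelibProcess.dist_add_dist {X : Type*} {n : ℕ} {d : X → X → ℝ} {R : (Fin n → X) → X}
    {ε : ℝ} {V : ℕ → Fin n → X} (hV : DelibProcess d R ε V) (hd0 : ∀ x y, d x y = 0 ↔ x = y)
    (hdsymm : ∀ x y, d x y = d y x) (j : ℕ) (i : Fin n) :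
    d (V j i) (V (j + 1) i) + d (V (j + 1) i) (R (V j)) = d (V j i) (R (V j)) := by
  obtain ⟨hdist, hstep, -⟩ := hV i j
  rcases (le_max_left 0 (d (V j i) (R (V j)) - ε)).eq_or_lt with h | h
  · rw [← h] at hdist
    rw [(hd0 _ _).1 hdist, (hd0 _ _).2 rfl, add_zero]
  · rw [hdsymm (V j i), hstep (hdist ▸ h), hdist,
      max_eq_right ((lt_max_iff.1 h).resolve_left (lt_irrefl 0)).le]
    ring

/-- Under a Kemeny-style rule, the winner does not change from one iteration to the next. -/
theorem DelibProcess.winner_succ {X : Type*} {n : ℕ} {d : X → X → ℝ} {R : (Fin n → X) → X}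
    {ε : ℝ} {V : ℕ → Fin n → X} (hV : DelibProcess d R ε V) (hd0 : ∀ x y, d x y = 0 ↔ x = y)
    (hdsymm : ∀ x y, d x y = d y x) (hdtri : ∀ x y z, d x z ≤ d x y + d y z)
    (hR : ∀ (U : Fin n → X) (x : X), x ≠ R U → ∑ i, d (U i) (R U) < ∑ i, d (U i) x) (j : ℕ) :
    R (V (j + 1)) = R (V j) := by
  by_contra hne
  have hold := hR (V j) _ hne
  have hnew := hR (V (j + 1)) _ (Ne.symm hne)
  have hsplit : ∑ i, d (V j i) (R (V j)) =
      ∑ i, d (V j i) (V (j + 1) i) + ∑ i, d (V (j + 1) i) (R (V j)) := by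
    rw [← Finset.sum_add_distrib]
    exact Finset.sum_congr rfl fun i _ => (hV.dist_add_dist hd0 hdsymm j i).symm
  have htri : ∑ i, d (V j i) (R (V (j + 1))) ≤
      ∑ i, d (V j i) (V (j + 1) i) + ∑ i, d (V (j + 1) i) (R (V (j + 1))) := by
    rw [← Finset.sum_add_distrib]
    exact Finset.sum_le_sum fun i _ => hdtri _ _ _
  linarith

/-- While the winner is invariant, distances to it shrink by `ε` per iteration until they vanish. -/
theorem DelibProcess.dist_winner {X : Type*} {n : ℕ} {d : X → X → ℝ} {R : (Fin n → X) → X}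
    {ε : ℝ} {V : ℕ → Fin n → X} (hV : DelibProcess d R ε V) (hε : 0 ≤ ε)
    (hnonneg : ∀ x y, 0 ≤ d x y) (hwin : ∀ j, R (V j) = R (V 0)) (i : Fin n) (j : ℕ) :
    d (V j i) (R (V 0)) = max 0 (d (V 0 i) (R (V 0)) - j * ε) := by
  induction j with
  | zero => simp [hnonneg]
  | succ j ih =>
    have h := (hV i j).1
    rw [hwin j, ih] at h
    rw [h, ← max_sub_sub_right, ← max_assoc, max_eq_left (by linarith : 0 - ε ≤ 0)]
    push_cast
    ring_nf

/-- On the set of rankings of m candidates (bijections Fin m → Fin m, mapping each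
candidate to its position), with an arbitrary metric d, and a Kemeny-style rule R
returning the unique minimizer of the sum of distances to the profile: in every
deliberation process the winner is invariant, and the process converges to the
consensus w^0 after exactly max_i ⌈d(v_i^0, w^0)/ε⌉ iterations. -/
theorem stmt16 {m n : ℕ}
    (d : Equiv.Perm (Fin m) → Equiv.Perm (Fin m) → ℝ)
    (hd0 : ∀ x y, d x y = 0 ↔ x = y)
    (hdsymm : ∀ x y, d x y = d y x)
    (hdtri : ∀ x y z, d x z ≤ d x y + d y z)
    {ε : ℝ} (hε : 0 < ε)
    (R : (Fin n → Equiv.Perm (Fin m)) → Equiv.Perm (Fin m))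
    (hR : ∀ (U : Fin n → Equiv.Perm (Fin m)) (x : Equiv.Perm (Fin m)), x ≠ R U →
      ∑ i : Fin n, d (U i) (R U) < ∑ i : Fin n, d (U i) x)
    (V : ℕ → Fin n → Equiv.Perm (Fin m)) (hV : DelibProcess d R ε V) :
    (∀ j : ℕ, R (V j) = R (V 0)) ∧
    (∀ j : ℕ,
      (Finset.univ.sup fun i : Fin n => ⌈d (V 0 i) (R (V 0)) / ε⌉₊) ≤ j →
      ∀ i : Fin n, V j i = R (V 0)) ∧
    (∀ j : ℕ,
      j < (Finset.univ.sup fun i : Fin n => ⌈d (V 0 i) (R (V 0)) / ε⌉₊) →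
      ∃ i : Fin n, V j i ≠ R (V 0)) ∧
    Converges V := by
  have hwin : ∀ j, R (V j) = R (V 0) := fun j => by
    induction j with
    | zero => rfl
    | succ j ih => rw [hV.winner_succ hd0 hdsymm hdtri hR, ih]
  have hreach : ∀ i j, V j i = R (V 0) ↔ ⌈d (V 0 i) (R (V 0)) / ε⌉₊ ≤ j := fun i j => by
    rw [← hd0, hV.dist_winner hε.le (dist_nonneg_of_triangle hd0 hdsymm hdtri) hwin,
      max_eq_left_iff, sub_nonpos, Nat.ceil_le, div_le_iff₀ hε]
  have hcons : ∀ j, (Finset.univ.sup fun i : Fin n => ⌈d (V 0 i) (R (V 0)) / ε⌉₊) ≤ j →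
      ∀ i : Fin n, V j i = R (V 0) := fun j hj i =>
    (hreach i j).2 (Finset.sup_le_iff.1 hj i (Finset.mem_univ i))
  refine ⟨hwin, hcons, fun j hj => ?_,
    Finset.univ.sup fun i : Fin n => ⌈d (V 0 i) (R (V 0)) / ε⌉₊, fun j hj => funext fun i => ?_⟩
  · obtain ⟨i, -, hi⟩ := Finset.lt_sup_iff.1 hj
    exact ⟨i, fun h => hi.not_ge ((hreach i j).1 h)⟩
  · exact (hcons j hj i).trans (hcons _ le_rfl i).symm
end
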